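/- Let ω, σ be weights on ℝⁿ with [ω]_{A∞} < ∞ and [σ]_{A∞} < ∞, let 𝒮 be an η-sparse collection of dyadic cubes, r ∈ (0,∞), α ∈ (0,1], and 1 < p ≤ q < ∞ with −α + 1/q + 1/p' ≥ 0, and assume p > r. Then there is a constant C depending only on n, p, q, r, α, η such that the testing constant 𝒯* satisfies: 𝒯* ≤ C · [ω,σ]_{A^α_{pq}(𝒮)}^r · [ω]_{A∞}^{1−(r/p)²} [σ]_{A∞}^{(r/p)²} in the case that p = q and α < 1; and 𝒯* ≤ C · [ω,σ]_{A^α_{pq}(𝒮)}^r · [ω]_{A∞}^{1−r/p} in all other cases. -/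

import Mathlib

open MeasureTheory ENNReal Set

noncomputable section

/-- An axis-parallel (closed) cube in ℝⁿ with corner `corner` and side length `side > 0`. -/
structure Cube (n : ℕ) where
  corner : Fin n → ℝ
  side : ℝ
  side_pos : 0 < side

namespace Cube

/-- The set of points of the cube. -/
def carrier {n : ℕ} (Q : Cube n) : Set (Fin n → ℝ) :=
  {x | ∀ i, Q.corner i ≤ x i ∧ x i ≤ Q.corner i + Q.side}

/-- The volume `|Q|` of the cube. -/
def vol {n : ℕ} (Q : Cube n) : ℝ := Q.side ^ n

/-- `Q` is a cube of the standard dyadic grid: `Q = 2^{-j}([0,1]^n + m)`. -/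
def IsDyadic {n : ℕ} (Q : Cube n) : Prop :=
  ∃ (j : ℤ) (m : Fin n → ℤ),
    Q.side = (2 : ℝ) ^ (-j) ∧ ∀ i, Q.corner i = (m i : ℝ) * (2 : ℝ) ^ (-j)

end Cube

/-- `η`-sparseness of a collection of cubes: there are pairwise disjoint measurable
subsets `E Q ⊆ Q` with `|E Q| ≥ η |Q|`. -/
def IsSparse {n : ℕ} (η : ℝ) (S : Set (Cube n)) : Prop :=
  ∃ E : Cube n → Set (Fin n → ℝ),
    (∀ Q ∈ S, MeasurableSet (E Q)) ∧ (∀ Q ∈ S, E Q ⊆ Q.carrier) ∧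
    (S.Pairwise (fun Q Q' => Disjoint (E Q) (E Q'))) ∧
    (∀ Q ∈ S, ENNReal.ofReal (η * Q.vol) ≤ volume (E Q))

/-- A weight: a nonnegative locally integrable function on ℝⁿ. -/
def IsWeight {n : ℕ} (w : (Fin n → ℝ) → ℝ) : Prop :=
  MeasureTheory.LocallyIntegrable w volume ∧ ∀ x, 0 ≤ w x

/-- `ω(Q) = ∫_Q ω`. -/
def wMass {n : ℕ} (w : (Fin n → ℝ) → ℝ) (Q : Cube n) : ℝ≥0∞ :=
  ∫⁻ x in Q.carrier, ENNReal.ofReal (w x)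

/-- The weighted `L^s` (quasi)norm `‖f‖_{L^s_w} = (∫ |f|^s w)^{1/s}`, valued in `ℝ≥0∞`. -/
def wNorm {n : ℕ} (s : ℝ) (w f : (Fin n → ℝ) → ℝ) : ℝ≥0∞ :=
  (∫⁻ x, ENNReal.ofReal (|f x| ^ s) * ENNReal.ofReal (w x)) ^ (1 / s)

/-- The weighted `L^s` (quasi)norm of an `ℝ≥0∞`-valued function. -/
def eNorm {n : ℕ} (s : ℝ) (w : (Fin n → ℝ) → ℝ) (g : (Fin n → ℝ) → ℝ≥0∞) : ℝ≥0∞ :=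
  (∫⁻ x, g x ^ s * ENNReal.ofReal (w x)) ^ (1 / s)

/-- `Σ_{Q ∈ D} g(Q) 1_Q`. -/
def cubeSum {n : ℕ} (D : Set (Cube n)) (g : Cube n → ℝ≥0∞) (x : Fin n → ℝ) : ℝ≥0∞ :=
  ∑' Q : D, Q.1.carrier.indicator (fun _ => g Q.1) x

/-- The sparse operator `A^{r,α}_S f = (Σ_{Q∈S} (|Q|^{-α} ∫_Q f)^r 1_Q)^{1/r}`
(for nonnegative `f`; negative values are truncated). -/
def sparseOp {n : ℕ} (S : Set (Cube n)) (r α : ℝ) (f : (Fin n → ℝ) → ℝ)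
    (x : Fin n → ℝ) : ℝ≥0∞ :=
  (cubeSum S
      (fun Q => ((ENNReal.ofReal Q.vol) ^ (-α) * ∫⁻ y in Q.carrier, ENNReal.ofReal (f y)) ^ r)
      x) ^ (1 / r)

/-- The Hardy–Littlewood maximal function over axis-parallel cubes. -/
def maximal {n : ℕ} (w : (Fin n → ℝ) → ℝ) (x : Fin n → ℝ) : ℝ≥0∞ :=
  ⨆ (Q : Cube n) (_ : x ∈ Q.carrier),
    (ENNReal.ofReal Q.vol)⁻¹ * ∫⁻ y in Q.carrier, ENNReal.ofReal |w y|

/-- The Fujii–Wilson `A∞`-characteristic `[w]_{A∞} = sup_Q ω(Q)⁻¹ ∫_Q M(1_Q ω)`. -/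
def AinfChar {n : ℕ} (w : (Fin n → ℝ) → ℝ) : ℝ≥0∞ :=
  ⨆ Q : Cube n, (wMass w Q)⁻¹ * ∫⁻ x in Q.carrier, maximal (Q.carrier.indicator w) x

/-- The two-weight characteristic
`[ω,σ]_{A^α_{pq}(S)} = sup_{Q∈S} |Q|^{-α} ω(Q)^{1/q} σ(Q)^{1/p'}` (here `1/p' = 1 - 1/p`). -/
def twoWeightChar {n : ℕ} (p q α : ℝ) (S : Set (Cube n)) (w σ' : (Fin n → ℝ) → ℝ) : ℝ≥0∞ :=
  ⨆ Q ∈ S, (ENNReal.ofReal Q.vol) ^ (-α) * wMass w Q ^ (1 / q) * wMass σ' Q ^ (1 - 1 / p)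

/-- The one-weight characteristic
`[w]_{A_{pq}} = sup_Q (|Q|⁻¹ ∫_Q w^q)(|Q|⁻¹ ∫_Q w^{-p'})^{q/p'}`, `p' = p/(p-1)`. -/
def ApqChar {n : ℕ} (p q : ℝ) (w : (Fin n → ℝ) → ℝ) : ℝ≥0∞ :=
  ⨆ Q : Cube n,
    ((ENNReal.ofReal Q.vol)⁻¹ * ∫⁻ x in Q.carrier, (ENNReal.ofReal (w x)) ^ q) *
      ((ENNReal.ofReal Q.vol)⁻¹ *
          ∫⁻ x in Q.carrier, (ENNReal.ofReal (w x)) ^ (-(p / (p - 1)))) ^ (q / (p / (p - 1)))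

/-- The testing constant `𝒯`. -/
def testT {n : ℕ} (p q r α : ℝ) (S : Set (Cube n)) (w σ' : (Fin n → ℝ) → ℝ) : ℝ≥0∞ :=
  ⨆ R ∈ S,
    wMass σ' R ^ (-(r / p)) *
      eNorm (q / r) w
        (cubeSum {Q | Q ∈ S ∧ Q.carrier ⊆ R.carrier}
          (fun Q => (ENNReal.ofReal Q.vol) ^ (-(α * r)) * wMass σ' Q ^ r))

/-- The testing constant `𝒯*`; here `1/(q/r)' = 1 - r/q` and `(p/r)' = (p/r)/((p/r)-1)`. -/
def testTstar {n : ℕ} (p q r α : ℝ) (S : Set (Cube n)) (w σ' : (Fin n → ℝ) → ℝ) : ℝ≥0∞ :=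
  ⨆ R ∈ S,
    wMass w R ^ (-(1 - r / q)) *
      eNorm ((p / r) / (p / r - 1)) σ'
        (cubeSum {Q | Q ∈ S ∧ Q.carrier ⊆ R.carrier}
          (fun Q => (ENNReal.ofReal Q.vol) ^ (-(α * r)) * wMass σ' Q ^ (r - 1) * wMass w Q))

/-- The operator (quasi)norm of `A^{r,α}_S(·σ) : L^p_σ → L^q_ω`, i.e. the least constant `K`
with `‖A^{r,α}_S(fσ)‖_{L^q_ω} ≤ K ‖f‖_{L^p_σ}` for all `f`. -/
def sparseOpNorm {n : ℕ} (p q r α : ℝ) (S : Set (Cube n)) (w σ' : (Fin n → ℝ) → ℝ) : ℝ≥0∞ :=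
  sInf {K : ℝ≥0∞ | ∀ f : (Fin n → ℝ) → ℝ, Measurable f →
    eNorm q w (sparseOp S r α (fun y => f y * σ' y)) ≤ K * wNorm p σ' f}

theorem ENNReal.sum_rpow_mul_rpow_le {ι : Type*} (T : Finset ι) (f g : ι → ℝ≥0∞) {θ : ℝ}
    (h0 : 0 ≤ θ) (h1 : θ ≤ 1) :
    ∑ i ∈ T, f i ^ θ * g i ^ (1 - θ) ≤ (∑ i ∈ T, f i) ^ θ * (∑ i ∈ T, g i) ^ (1 - θ) := by
  rcases h0.eq_or_lt with rfl | h0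
  · simp
  rcases h1.eq_or_lt with rfl | h1
  · simp
  have hc : (1 / θ).HolderConjugate (1 / (1 - θ)) := by
    rw [Real.holderConjugate_iff]
    refine ⟨by rw [lt_div_iff₀ h0]; linarith, by simp⟩
  refine (ENNReal.inner_le_Lp_mul_Lq T _ _ hc).trans (le_of_eq ?_)
  have e1 : θ * (1 / θ) = 1 := by field_simp
  have e2 : (1 - θ) * (1 / (1 - θ)) = 1 := by
    have : 1 - θ ≠ 0 := by linarith
    field_simp
  simp only [← ENNReal.rpow_mul, e1, e2, ENNReal.rpow_one, one_div_one_div]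

theorem ENNReal.add_rpow_le_rpow_add_mul (x y : ℝ≥0∞) {s : ℝ} (hs : 1 ≤ s) :
    (x + y) ^ s ≤ x ^ s + ENNReal.ofReal s * y * (x + y) ^ (s - 1) := by
  have hs0 : 0 < s := by linarith
  have hso : ENNReal.ofReal s ≠ 0 := by simpa using hs0
  rcases eq_or_ne x ⊤ with rfl | hx
  · simp [hs0]
  rcases eq_or_ne y ⊤ with rfl | hy
  · rcases hs.eq_or_lt with rfl | hs1
    · simp
    · simp [hs0, hs1, ENNReal.mul_top hso]
  lift x to NNReal using hx
  lift y to NNReal using hy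
  rcases eq_or_ne (x + y) 0 with h | h
  · obtain ⟨rfl, rfl⟩ := add_eq_zero.1 h
    simp [hs0]
  have hc : (0 : ℝ) < x + y := by exact_mod_cast pos_iff_ne_zero.2 h
  have key : ((x : ℝ) + y) ^ s ≤ (x : ℝ) ^ s + s * y * ((x : ℝ) + y) ^ (s - 1) := by
    have hb := one_add_mul_self_le_rpow_one_add (s := -(y : ℝ) / (x + y)) (p := s)
      (by rw [le_div_iff₀ hc]; linarith [x.2, show (0:ℝ) ≤ x from x.2]) hs
    have e : 1 + -(y : ℝ) / (x + y) = x / (x + y) := by field_simp; ring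
    rw [e, Real.div_rpow (NNReal.coe_nonneg x) hc.le, le_div_iff₀ (by positivity)] at hb
    have e3 : ((x : ℝ) + y) ^ s = (x + y) ^ (s - 1) * (x + y) := by
      rw [← Real.rpow_add_one hc.ne']; ring_nf
    have e4 : (1 + s * (-(y : ℝ) / (x + y))) * ((x : ℝ) + y) ^ s =
        ((x : ℝ) + y) ^ s - s * y * (x + y) ^ (s - 1) := by
      rw [e3]; field_simp; ring
    rw [e4] at hb
    linarith
  have := ENNReal.ofReal_le_ofReal key
  rw [ENNReal.ofReal_add (by positivity) (by positivity), ENNReal.ofReal_mul (by positivity),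
    ENNReal.ofReal_mul hs0.le, ← ENNReal.ofReal_rpow_of_nonneg (by positivity) (by positivity),
    ← ENNReal.ofReal_rpow_of_nonneg (by positivity) (by positivity),
    ← ENNReal.ofReal_rpow_of_pos hc,
    ENNReal.ofReal_add (by positivity) (by positivity)] at this
  simpa using this

/-- Summation by parts for the power of a finite sum, ordered by a key. -/
theorem ENNReal.sum_rpow_le_of_key {ι : Type*} (T : Finset ι) (f : ι → ℝ) (a : ι → ℝ≥0∞)
    {s : ℝ} (hs : 1 ≤ s) :
    (∑ i ∈ T, a i) ^ s ≤
      ENNReal.ofReal s * ∑ i ∈ T, a i * (∑ j ∈ T with f j ≤ f i, a j) ^ (s - 1) := by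
  classical
  induction T using Finset.induction_on_max_value f with
  | empty => simp; linarith
  | insert i T hi hmax ih =>
    have e : (insert i T).filter (fun j => f j ≤ f i) = insert i T := by
      apply Finset.filter_true_of_mem
      intro j hj
      rcases Finset.mem_insert.1 hj with rfl | hj
      · exact le_rfl
      · exact hmax j hj
    rw [Finset.sum_insert hi, Finset.sum_insert hi, e, Finset.sum_insert hi, add_comm (a i)]
    refine (ENNReal.add_rpow_le_rpow_add_mul _ _ hs).trans ?_
    rw [mul_add, add_comm, mul_assoc]
    gcongr
    refine ih.trans ?_
    refine mul_le_mul_right (Finset.sum_le_sum fun j hj => ?_) _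
    exact mul_le_mul_right (ENNReal.rpow_le_rpow (Finset.sum_le_sum_of_subset
      (Finset.filter_subset_filter _ (Finset.subset_insert _ _))) (by linarith)) _

theorem ENNReal.exists_eq_ofReal_exp {x : ℝ≥0∞} (h0 : x ≠ 0) (h1 : x ≠ ⊤) :
    ∃ y : ℝ, x = ENNReal.ofReal (Real.exp y) :=
  ⟨Real.log x.toReal, by
    rw [Real.exp_log (ENNReal.toReal_pos h0 h1), ENNReal.ofReal_toReal h1]⟩

theorem ENNReal.ofReal_exp_rpow (y t : ℝ) :
    ENNReal.ofReal (Real.exp y) ^ t = ENNReal.ofReal (Real.exp (y * t)) := by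
  rw [ENNReal.ofReal_rpow_of_pos (Real.exp_pos y), Real.exp_mul]

theorem ENNReal.ofReal_exp_mul (y z : ℝ) :
    ENNReal.ofReal (Real.exp y) * ENNReal.ofReal (Real.exp z) =
      ENNReal.ofReal (Real.exp (y + z)) := by
  rw [← ENNReal.ofReal_mul (Real.exp_pos y).le, Real.exp_add]

theorem ENNReal.ofReal_exp_inv (y : ℝ) :
    (ENNReal.ofReal (Real.exp y))⁻¹ = ENNReal.ofReal (Real.exp (-y)) := by
  rw [← ENNReal.ofReal_inv_of_pos (Real.exp_pos y), Real.exp_neg]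

/-- If `X ≤ c X^{1-θ} Y^θ` with `X` finite, then `X ≤ c^{1/θ} Y`. -/
theorem ENNReal.le_of_le_mul_rpow {X Y c : ℝ≥0∞} {θ : ℝ} (h0 : 0 < θ) (hX : X ≠ ⊤)
    (h : X ≤ c * (X ^ (1 - θ) * Y ^ θ)) : X ≤ c ^ (1 / θ) * Y := by
  rcases eq_or_ne X 0 with rfl | hX0
  · simp
  have h2 : X ^ θ ≤ c * Y ^ θ := by
    have hne : X ^ (1 - θ) ≠ 0 := by simp [hX0, hX]
    have hnt : X ^ (1 - θ) ≠ ⊤ := by simp [hX0, hX]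
    rw [← ENNReal.mul_le_mul_iff_right hne hnt, ← ENNReal.rpow_add _ _ hX0 hX]
    calc X ^ (1 - θ + θ) = X := by simp
      _ ≤ _ := h
      _ = _ := by ring
  have h3 := ENNReal.rpow_le_rpow h2 (z := 1 / θ) (by positivity)
  rw [ENNReal.mul_rpow_of_nonneg _ _ (by positivity), ← ENNReal.rpow_mul, ← ENNReal.rpow_mul] at h3
  simpa [h0.ne'] using h3

/-- A discrete Carleson-type inequality on a finite family whose ancestors form chains. -/
theorem ENNReal.sum_mul_ancestors_rpow_le {ι : Type*} (T : Finset ι) (le : ι → ι → Prop)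
    [DecidableRel le] (side : ι → ℝ)
    (hchain : ∀ i ∈ T, ∀ j ∈ T, ∀ k ∈ T, le i j → le i k → side j ≤ side k → le j k)
    (l ν m : ι → ℝ≥0∞) (hl : ∀ i ∈ T, l i ≠ ⊤) (hν : ∀ i ∈ T, ν i ≠ ⊤)
    (hm : ∀ i ∈ T, ∑ j ∈ T with le j i, l j * ν j ≤ ν i * m i) {c : ℝ} (hc : 1 ≤ c) :
    ∑ i ∈ T, l i * ν i * (∑ j ∈ T with le i j, l j) ^ c ≤
      ENNReal.ofReal c ^ c * ∑ i ∈ T, l i * ν i * m i ^ c := by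
  have hc0 : 0 < c := by linarith
  set G : ι → ℝ≥0∞ := fun i => ∑ j ∈ T with le i j, l j with hG
  have hX : ∑ i ∈ T, l i * ν i * G i ^ c ≠ ⊤ := by
    refine ENNReal.sum_ne_top.2 fun i hi => ENNReal.mul_ne_top (ENNReal.mul_ne_top (hl i hi) (hν i hi))
      (ENNReal.rpow_ne_top_of_nonneg hc0.le ?_)
    exact ENNReal.sum_ne_top.2 fun j hj => hl j (Finset.mem_filter.1 hj).1
  have step : ∀ i ∈ T, G i ^ c ≤
      ENNReal.ofReal c * ∑ j ∈ T with le i j, l j * G j ^ (c - 1) := by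
    intro i hi
    refine (ENNReal.sum_rpow_le_of_key _ (fun j => - side j) l hc).trans ?_
    refine mul_le_mul_right (Finset.sum_le_sum fun j hj => ?_) _
    refine mul_le_mul_right (ENNReal.rpow_le_rpow (Finset.sum_le_sum_of_subset fun k hk => ?_)
      (by linarith)) _
    simp only [Finset.mem_filter] at hk hj ⊢
    exact ⟨hk.1.1, hchain i hi j hj.1 k hk.1.1 hj.2 hk.1.2 (by linarith [hk.2])⟩
  have main : ∑ i ∈ T, l i * ν i * G i ^ c ≤ ENNReal.ofReal c *
      ((∑ i ∈ T, l i * ν i * G i ^ c) ^ (1 - 1 / c) * (∑ i ∈ T, l i * ν i * m i ^ c) ^ (1 / c)) := by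
    calc ∑ i ∈ T, l i * ν i * G i ^ c
        ≤ ∑ i ∈ T, l i * ν i * (ENNReal.ofReal c * ∑ j ∈ T with le i j, l j * G j ^ (c - 1)) := by
          gcongr with i hi
          exact step i hi
      _ = ENNReal.ofReal c * ∑ j ∈ T, (l j * G j ^ (c - 1)) * ∑ i ∈ T with le i j, l i * ν i := by
          simp only [Finset.mul_sum, Finset.sum_filter]
          rw [Finset.sum_comm]
          refine Finset.sum_congr rfl fun j _ => Finset.sum_congr rfl fun i _ => ?_
          split_ifs <;> ring
      _ ≤ ENNReal.ofReal c * ∑ j ∈ T, (l j * G j ^ (c - 1)) * (ν j * m j) := by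
          gcongr with j hj
          exact hm j hj
      _ = ENNReal.ofReal c * ∑ j ∈ T, (l j * ν j * G j ^ c) ^ (1 - 1 / c) *
            (l j * ν j * m j ^ c) ^ (1 - (1 - 1 / c)) := by
          congr 1
          refine Finset.sum_congr rfl fun j _ => ?_
          have h1 : 0 ≤ 1 - 1 / c := by
            rw [sub_nonneg, div_le_one hc0]; exact hc
          have h2 : (0:ℝ) ≤ 1 / c := by positivity
          have e1 : c * (1 - 1 / c) = c - 1 := by field_simp
          have e2 : c * (1 / c) = 1 := by field_simp
          have e0 : 1 - (1 - 1 / c) = 1 / c := by ring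
          rw [e0, ENNReal.mul_rpow_of_nonneg _ _ h1, ENNReal.mul_rpow_of_nonneg _ _ h2,
            ← ENNReal.rpow_mul, ← ENNReal.rpow_mul, e1, e2, ENNReal.rpow_one]
          have e3 : l j * ν j = (l j * ν j) ^ (1 - 1 / c) * (l j * ν j) ^ (1 / c) := by
            rw [← ENNReal.rpow_add_of_nonneg _ _ h1 h2]; simp
          calc _ = (l j * ν j) * (G j ^ (c - 1) * m j) := by ring
            _ = _ := by conv_lhs => rw [e3]
                        ring
      _ ≤ _ := by
          have := ENNReal.sum_rpow_mul_rpow_le T (fun j => l j * ν j * G j ^ c)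
            (fun j => l j * ν j * m j ^ c) (θ := 1 - 1 / c)
            (by rw [sub_nonneg, div_le_one hc0]; exact hc) (by simp; positivity)
          have e0 : 1 - (1 - 1 / c) = 1 / c := by ring
          rw [e0] at this ⊢
          gcongr
  have := ENNReal.le_of_le_mul_rpow (by positivity) hX main
  simpa using this
namespace Cube

variable {n : ℕ}

/-- The open cube with the same corner and side. -/
def openCarrier (Q : Cube n) : Set (Fin n → ℝ) :=
  Set.pi univ fun i => Ioo (Q.corner i) (Q.corner i + Q.side)

theorem carrier_eq_Icc (Q : Cube n) :
    Q.carrier = Icc Q.corner (fun i => Q.corner i + Q.side) := by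
  ext x
  simp only [carrier, Set.mem_ofPred_eq, Set.mem_Icc, Pi.le_def]
  exact forall_and

theorem measurableSet_carrier (Q : Cube n) : MeasurableSet Q.carrier := by
  rw [carrier_eq_Icc]; exact measurableSet_Icc

theorem volume_carrier (Q : Cube n) : volume Q.carrier = ENNReal.ofReal Q.vol := by
  rw [carrier_eq_Icc, Real.volume_Icc_pi]
  simp [vol, ENNReal.ofReal_pow Q.side_pos.le]

theorem vol_pos (Q : Cube n) : 0 < Q.vol := pow_pos Q.side_pos n

theorem ae_mem_openCarrier (Q : Cube n) :
    ∀ᵐ x ∂(volume : Measure (Fin n → ℝ)), x ∈ Q.carrier → x ∈ Q.openCarrier := by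
  have h : Q.openCarrier =ᵐ[volume] Icc Q.corner (fun i => Q.corner i + Q.side) :=
    Measure.univ_pi_Ioo_ae_eq_Icc
  rw [← carrier_eq_Icc] at h
  filter_upwards [h] with x hx hxQ
  exact hx.symm.mp hxQ

theorem openCarrier_mono {Q Q' : Cube n} (h : Q.carrier ⊆ Q'.carrier) :
    Q.openCarrier ⊆ Q'.openCarrier := by
  intro x hx i _
  have hs := Q.side_pos
  have h1 := h (show Q.corner ∈ Q.carrier from fun i => ⟨le_rfl, by linarith⟩) i
  have h2 := h (show (fun i => Q.corner i + Q.side) ∈ Q.carrier from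
    fun i => ⟨by simp only; linarith, le_rfl⟩) i
  have := hx i trivial
  exact ⟨h1.1.trans_lt this.1, this.2.trans_le h2.2⟩

theorem openCarrier_nonempty (Q : Cube n) : Q.openCarrier.Nonempty := by
  have hs := Q.side_pos
  exact ⟨fun i => Q.corner i + Q.side / 2, fun i _ => ⟨by simp only; linarith, by
    simp only; linarith⟩⟩

theorem side_le_of_subset (hn : 1 ≤ n) {Q Q' : Cube n} (h : Q.carrier ⊆ Q'.carrier) :
    Q.side ≤ Q'.side := by
  have hs := Q.side_pos
  have h1 := h (show Q.corner ∈ Q.carrier from fun i => ⟨le_rfl, by linarith⟩) ⟨0, hn⟩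
  have h2 := h (show (fun i => Q.corner i + Q.side) ∈ Q.carrier from
    fun i => ⟨by simp only; linarith, le_rfl⟩) ⟨0, hn⟩
  linarith [h1.1, h2.2]

theorem IsDyadic.subset_of_mem {Q Q' : Cube n} (hQ : Q.IsDyadic) (hQ' : Q'.IsDyadic)
    {x : Fin n → ℝ} (hx : x ∈ Q.openCarrier) (hx' : x ∈ Q'.openCarrier)
    (hside : Q.side ≤ Q'.side) : Q.carrier ⊆ Q'.carrier := by
  obtain ⟨j, m, hs, hc⟩ := hQ
  obtain ⟨j', m', hs', hc'⟩ := hQ'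
  have hjj : j' ≤ j := by
    rw [hs, hs', zpow_le_zpow_iff_right₀ (by norm_num)] at hside
    omega
  obtain ⟨k, rfl⟩ := Int.le.dest hjj
  have hpos : (0 : ℝ) < 2 ^ (-(j' + k) : ℤ) := by positivity
  have hrel : (2 : ℝ) ^ (-j' : ℤ) = (2 ^ k : ℤ) * 2 ^ (-(j' + k) : ℤ) := by
    push_cast
    rw [← zpow_natCast, ← zpow_add₀ (by norm_num)]
    congr 1; ring
  set d : ℝ := 2 ^ (-(j' + k) : ℤ) with hd
  intro y hy i
  have h1 := hx i trivial
  have h2 := hx' i trivial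
  have h3 := hy i
  simp only [Set.mem_Ioo] at h1 h2
  rw [hc i, hs] at h1 h3
  rw [hc' i, hs', hrel] at h2
  rw [hc' i, hs', hrel]
  have e1 : m' i * 2 ^ k < m i + 1 := by
    have : ((m' i : ℝ) * (2 ^ k : ℤ)) * d < (m i + 1) * d := by linarith [h1.2, h2.1]
    have := lt_of_mul_lt_mul_right this hpos.le
    exact_mod_cast this
  have e2 : m i < (m' i + 1) * 2 ^ k := by
    have : (m i : ℝ) * d < (((m' i : ℝ) + 1) * (2 ^ k : ℤ)) * d := by linarith [h1.1, h2.2]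
    have := lt_of_mul_lt_mul_right this hpos.le
    exact_mod_cast this
  have f1 : ((m' i : ℝ) * (2 ^ k : ℤ)) ≤ m i := by exact_mod_cast Int.lt_add_one_iff.1 e1
  have f2 : (m i : ℝ) + 1 ≤ ((m' i : ℝ) + 1) * (2 ^ k : ℤ) := by exact_mod_cast e2
  have g1 := mul_le_mul_of_nonneg_right f1 hpos.le
  have g2 := mul_le_mul_of_nonneg_right f2 hpos.le
  constructor <;> linarith [h3.1, h3.2]

theorem eq_of_subset_of_side_eq {Q Q' : Cube n} (h : Q.carrier ⊆ Q'.carrier)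
    (h' : Q.side = Q'.side) : Q = Q' := by
  have hs := Q.side_pos
  have hc : Q.corner = Q'.corner := by
    ext i
    have h1 := h (show Q.corner ∈ Q.carrier from fun i => ⟨le_rfl, by linarith⟩) i
    have h2 := h (show (fun i => Q.corner i + Q.side) ∈ Q.carrier from
      fun i => ⟨by simp only; linarith, le_rfl⟩) i
    linarith [h1.1, h2.2]
  cases Q; cases Q'; simp_all

theorem countable_isDyadic : {Q : Cube n | Q.IsDyadic}.Countable := by
  have : {Q : Cube n | Q.IsDyadic} ⊆ Set.range (fun z : ℤ × (Fin n → ℤ) =>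
      (⟨fun i => (z.2 i : ℝ) * (2 : ℝ) ^ (-z.1), (2 : ℝ) ^ (-z.1), by positivity⟩ : Cube n)) := by
    rintro Q ⟨j, m, hs, hc⟩
    refine ⟨(j, m), ?_⟩
    have hc' : Q.corner = fun i => (m i : ℝ) * (2 : ℝ) ^ (-j) := funext hc
    cases Q; simp_all
  exact (Set.countable_range _).mono this

end Cube
namespace Cube

variable {n : ℕ}

open scoped Classical in
theorem sum_indicator_eq (T : Finset (Cube n)) (l : Cube n → ℝ≥0∞) (x : Fin n → ℝ) :
    ∑ Q ∈ T, Q.carrier.indicator (fun _ => l Q) x = ∑ Q ∈ T with x ∈ Q.carrier, l Q := by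
  simp only [Finset.sum_filter, Set.indicator_apply]

theorem lintegral_sum_indicator (T : Finset (Cube n)) (l : Cube n → ℝ≥0∞)
    (ν : Measure (Fin n → ℝ)) :
    ∫⁻ x, ∑ Q ∈ T, Q.carrier.indicator (fun _ => l Q) x ∂ν = ∑ Q ∈ T, l Q * ν Q.carrier := by
  rw [lintegral_finsetSum _ fun Q _ => measurable_const.indicator Q.measurableSet_carrier]
  exact Finset.sum_congr rfl fun Q _ => lintegral_indicator_const Q.measurableSet_carrier _

theorem ae_forall_mem_openCarrier {ν : Measure (Fin n → ℝ)} (hν : ν ≪ volume)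
    (T : Finset (Cube n)) : ∀ᵐ x ∂ν, ∀ Q ∈ T, x ∈ Q.carrier → x ∈ Q.openCarrier :=
  (ae_ball_iff T.countable_toSet).2 fun Q _ => hν.ae_le Q.ae_mem_openCarrier

theorem IsDyadic.chain {Q Q₁ Q₂ : Cube n} (h₁ : Q₁.IsDyadic) (h₂ : Q₂.IsDyadic)
    (hQ₁ : Q.carrier ⊆ Q₁.carrier) (hQ₂ : Q.carrier ⊆ Q₂.carrier) (hs : Q₁.side ≤ Q₂.side) :
    Q₁.carrier ⊆ Q₂.carrier := by
  obtain ⟨x, hx⟩ := Q.openCarrier_nonempty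
  exact h₁.subset_of_mem h₂ (openCarrier_mono hQ₁ hx) (openCarrier_mono hQ₂ hx) hs

open scoped Classical in
theorem lintegral_sum_rpow_le_ancestors {ν : Measure (Fin n → ℝ)} (hν : ν ≪ volume)
    (T : Finset (Cube n)) (hT : ∀ Q ∈ T, Q.IsDyadic) (l : Cube n → ℝ≥0∞) {s : ℝ} (hs : 1 ≤ s) :
    ∫⁻ x, (∑ Q ∈ T, Q.carrier.indicator (fun _ => l Q) x) ^ s ∂ν ≤
      ENNReal.ofReal s * ∑ Q ∈ T, l Q * ν Q.carrier *
        (∑ Q' ∈ T with Q.carrier ⊆ Q'.carrier, l Q') ^ (s - 1) := by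
  calc ∫⁻ x, (∑ Q ∈ T, Q.carrier.indicator (fun _ => l Q) x) ^ s ∂ν
      ≤ ∫⁻ x, ENNReal.ofReal s * ∑ Q ∈ T, Q.carrier.indicator (fun _ => l Q *
          (∑ Q' ∈ T with Q.carrier ⊆ Q'.carrier, l Q') ^ (s - 1)) x ∂ν := by
        refine lintegral_mono_ae ?_
        filter_upwards [ae_forall_mem_openCarrier hν T] with x hx
        rw [sum_indicator_eq, sum_indicator_eq]
        refine (ENNReal.sum_rpow_le_of_key _ (fun Q => - Q.side) l hs).trans ?_
        refine mul_le_mul_right (Finset.sum_le_sum fun Q hQ => ?_) _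
        refine mul_le_mul_right (ENNReal.rpow_le_rpow (Finset.sum_le_sum_of_subset
          fun Q' hQ' => ?_) (by linarith)) _
        simp only [Finset.mem_filter] at hQ hQ' ⊢
        exact ⟨hQ'.1.1, (hT _ hQ.1).subset_of_mem (hT _ hQ'.1.1) (hx _ hQ.1 hQ.2)
          (hx _ hQ'.1.1 hQ'.1.2) (by linarith [hQ'.2])⟩
    _ = _ := by
        rw [lintegral_const_mul, lintegral_sum_indicator]
        · simp only [mul_right_comm]
        · exact Finset.measurable_fun_sum _ fun Q _ =>
            measurable_const.indicator Q.measurableSet_carrier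

open scoped Classical in
theorem lintegral_sum_rpow_le_descendants {ν : Measure (Fin n → ℝ)} (hν : ν ≪ volume)
    (T : Finset (Cube n)) (hT : ∀ Q ∈ T, Q.IsDyadic) (l : Cube n → ℝ≥0∞)
    (hν0 : ∀ Q ∈ T, ν Q.carrier ≠ 0) (hνt : ∀ Q ∈ T, ν Q.carrier ≠ ⊤)
    {s : ℝ} (hs : 1 ≤ s) (hs2 : s ≤ 2) :
    ∫⁻ x, (∑ Q ∈ T, Q.carrier.indicator (fun _ => l Q) x) ^ s ∂ν ≤
      ENNReal.ofReal s * ∑ Q ∈ T, l Q * ν Q.carrier *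
        ((ν Q.carrier)⁻¹ * ∑ Q' ∈ T with Q'.carrier ⊆ Q.carrier, l Q' * ν Q'.carrier) ^ (s - 1) := by
  set F : Cube n → (Fin n → ℝ) → ℝ≥0∞ := fun Q x =>
    ∑ Q' ∈ T with Q'.carrier ⊆ Q.carrier, Q'.carrier.indicator (fun _ => l Q') x with hF
  have hFm : ∀ Q, Measurable (F Q) := fun Q => Finset.measurable_fun_sum _ fun Q _ =>
            measurable_const.indicator Q.measurableSet_carrier
  have hm : ∀ Q : Cube n, Measurable (Q.carrier.indicator (fun x => l Q * F Q x ^ (s - 1))) := fun Q =>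
    (((hFm Q).pow_const _).const_mul _).indicator Q.measurableSet_carrier
  calc ∫⁻ x, (∑ Q ∈ T, Q.carrier.indicator (fun _ => l Q) x) ^ s ∂ν
      ≤ ∫⁻ x, ENNReal.ofReal s * ∑ Q ∈ T, Q.carrier.indicator
          (fun x => l Q * F Q x ^ (s - 1)) x ∂ν := by
        refine lintegral_mono_ae ?_
        filter_upwards [ae_forall_mem_openCarrier hν T] with x hx
        rw [sum_indicator_eq]
        refine (ENNReal.sum_rpow_le_of_key _ (fun Q => Q.side) l hs).trans ?_
        refine mul_le_mul_right ?_ _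
        simp only [Set.indicator_apply, ← Finset.sum_filter]
        refine Finset.sum_le_sum fun Q hQ => ?_
        simp only [hF, sum_indicator_eq]
        refine mul_le_mul_right (ENNReal.rpow_le_rpow (Finset.sum_le_sum_of_subset
          fun Q' hQ' => ?_) (by linarith)) _
        simp only [Finset.mem_filter] at hQ hQ' ⊢
        exact ⟨⟨hQ'.1.1, (hT _ hQ'.1.1).subset_of_mem (hT _ hQ.1) (hx _ hQ'.1.1 hQ'.1.2)
          (hx _ hQ.1 hQ.2) hQ'.2⟩, hQ'.1.2⟩
    _ = ENNReal.ofReal s * ∑ Q ∈ T, l Q * ∫⁻ x in Q.carrier, F Q x ^ (s - 1) ∂ν := by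
        rw [lintegral_const_mul _ (Finset.measurable_fun_sum _ fun Q _ => hm Q),
          lintegral_finsetSum _ fun Q _ => hm Q]
        congr 1
        refine Finset.sum_congr rfl fun Q _ => ?_
        rw [lintegral_indicator Q.measurableSet_carrier, lintegral_const_mul _
          ((hFm Q).pow_const _)]
    _ ≤ _ := by
        refine mul_le_mul_right (Finset.sum_le_sum fun Q hQ => ?_) _
        rw [mul_assoc]
        refine mul_le_mul_right ?_ _
        have h1 := ENNReal.lintegral_mul_norm_pow_le (μ := ν.restrict Q.carrier)
          (hFm Q).aemeasurable (g := fun _ => (1 : ℝ≥0∞)) aemeasurable_const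
          (p := s - 1) (q := 2 - s) (by linarith) (by linarith) (by ring)
        simp only [ENNReal.one_rpow, mul_one, lintegral_const, Measure.restrict_apply_univ,
          one_mul] at h1
        have h2 : ∫⁻ x in Q.carrier, F Q x ∂ν ≤
            ∑ Q' ∈ T with Q'.carrier ⊆ Q.carrier, l Q' * ν Q'.carrier := by
          rw [← lintegral_sum_indicator]
          exact setLIntegral_le_lintegral _ _
        refine h1.trans ((mul_le_mul_left (ENNReal.rpow_le_rpow h2 (by linarith)) _).trans
          (le_of_eq ?_))
        rw [ENNReal.mul_rpow_of_nonneg _ _ (by linarith : 0 ≤ s - 1), ENNReal.inv_rpow,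
          ← ENNReal.rpow_neg, ← mul_assoc]
        have e : ν Q.carrier ^ (2 - s) = ν Q.carrier * ν Q.carrier ^ (-(s - 1)) := by
          conv_rhs => enter [1]; rw [← ENNReal.rpow_one (ν Q.carrier)]
          rw [← ENNReal.rpow_add _ _ (hν0 Q hQ) (hνt Q hQ)]
          congr 1; ring
        rw [e, mul_comm]

open scoped Classical in
/-- The upper half of the Cascante–Ortega–Verbitsky equivalence for finite dyadic sums. -/
theorem lintegral_sum_rpow_le {ν : Measure (Fin n → ℝ)} (hν : ν ≪ volume)
    (T : Finset (Cube n)) (hT : ∀ Q ∈ T, Q.IsDyadic) (l : Cube n → ℝ≥0∞)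
    (hl : ∀ Q ∈ T, l Q ≠ ⊤)
    (hν0 : ∀ Q ∈ T, ν Q.carrier ≠ 0) (hνt : ∀ Q ∈ T, ν Q.carrier ≠ ⊤)
    {s : ℝ} (hs : 1 ≤ s) :
    ∫⁻ x, (∑ Q ∈ T, Q.carrier.indicator (fun _ => l Q) x) ^ s ∂ν ≤
      ENNReal.ofReal s * ENNReal.ofReal s ^ (s - 1) * ∑ Q ∈ T, l Q * ν Q.carrier *
        ((ν Q.carrier)⁻¹ * ∑ Q' ∈ T with Q'.carrier ⊆ Q.carrier, l Q' * ν Q'.carrier) ^ (s - 1) := by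
  rw [mul_assoc]
  rcases le_total s 2 with hs2 | hs2
  · refine (lintegral_sum_rpow_le_descendants hν T hT l hν0 hνt hs hs2).trans ?_
    refine mul_le_mul_right (le_mul_of_one_le_left zero_le ?_) _
    simpa using ENNReal.rpow_le_rpow (show (1 : ℝ≥0∞) ≤ ENNReal.ofReal s by simpa using hs)
      (show 0 ≤ s - 1 by linarith)
  · refine (lintegral_sum_rpow_le_ancestors hν T hT l hs).trans ?_
    refine mul_le_mul_right ?_ _
    refine (ENNReal.sum_mul_ancestors_rpow_le T (fun Q Q' => Q.carrier ⊆ Q'.carrier) Cube.side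
      (fun i _ j hj k hk hij hik hs => (hT j hj).chain (hT k hk) hij hik hs) l
      (fun Q => ν Q.carrier) _ hl hνt (fun Q hQ => ?_) (by linarith)).trans
      (mul_le_mul_left (ENNReal.rpow_le_rpow (ENNReal.ofReal_le_ofReal (by linarith))
        (by linarith)) _)
    rw [← mul_assoc, ENNReal.mul_inv_cancel (hν0 Q hQ) (hνt Q hQ), one_mul]

/-- The constant `∑ 1/k²`. -/
def invSqSum : ℝ≥0∞ := ∑' k : ℕ, ENNReal.ofReal (1 / (k : ℝ) ^ 2)

theorem invSqSum_ne_top : invSqSum ≠ ⊤ :=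
  (Real.summable_one_div_nat_pow.2 (by norm_num)).tsum_ofReal_ne_top

open scoped Classical in
theorem sum_measure_mul_inv_sq_card_le (hn : 1 ≤ n) {ν : Measure (Fin n → ℝ)} (hν : ν ≪ volume)
    (T : Finset (Cube n)) (hT : ∀ Q ∈ T, Q.IsDyadic) (R : Cube n)
    (hR : ∀ Q ∈ T, Q.carrier ⊆ R.carrier) :
    ∑ Q ∈ T, ν Q.carrier *
        ENNReal.ofReal (1 / ((T.filter (fun Q' => Q.carrier ⊆ Q'.carrier)).card : ℝ) ^ 2) ≤
      invSqSum * ν R.carrier := by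
  set N : Cube n → ℕ := fun Q => (T.filter (fun Q' => Q.carrier ⊆ Q'.carrier)).card with hN
  have hlt : ∀ Q ∈ T, ∀ Q' ∈ T, Q.carrier ⊆ Q'.carrier → Q ≠ Q' → N Q' < N Q := by
    intro Q hQ Q' hQ' hsub hne
    refine Finset.card_lt_card ⟨fun P hP => ?_, fun h => hne ?_⟩
    · simp only [Finset.mem_filter] at hP ⊢
      exact ⟨hP.1, hsub.trans hP.2⟩
    · have := h (show Q ∈ _ from Finset.mem_filter.2 ⟨hQ, subset_rfl⟩)
      exact eq_of_subset_of_side_eq hsub (le_antisymm (side_le_of_subset hn hsub)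
        (side_le_of_subset hn (Finset.mem_filter.1 this).2))
  calc ∑ Q ∈ T, ν Q.carrier * ENNReal.ofReal (1 / (N Q : ℝ) ^ 2)
      = ∫⁻ x, ∑ Q ∈ T, Q.carrier.indicator
          (fun _ => ENNReal.ofReal (1 / (N Q : ℝ) ^ 2)) x ∂ν := by
        rw [lintegral_sum_indicator]; simp only [mul_comm]
    _ ≤ ∫⁻ x, R.carrier.indicator (fun _ => invSqSum) x ∂ν := by
        refine lintegral_mono_ae ?_
        filter_upwards [ae_forall_mem_openCarrier hν T] with x hx
        rw [sum_indicator_eq]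
        by_cases hxR : x ∈ R.carrier
        · rw [Set.indicator_of_mem hxR]
          have hinj : Set.InjOn N (T.filter (fun Q => x ∈ Q.carrier) : Finset (Cube n)) := by
            intro Q hQ Q' hQ' hNe
            simp only [Finset.coe_filter, Set.mem_ofPred_eq] at hQ hQ'
            by_contra hne
            rcases le_total Q.side Q'.side with h | h
            · exact (hlt Q hQ.1 Q' hQ'.1 ((hT _ hQ.1).subset_of_mem (hT _ hQ'.1) (hx _ hQ.1 hQ.2)
                (hx _ hQ'.1 hQ'.2) h) hne).ne hNe.symm
            · exact (hlt Q' hQ'.1 Q hQ.1 ((hT _ hQ'.1).subset_of_mem (hT _ hQ.1)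
                (hx _ hQ'.1 hQ'.2) (hx _ hQ.1 hQ.2) h) (Ne.symm hne)).ne hNe
          rw [← Finset.sum_image (f := fun k : ℕ => ENNReal.ofReal (1 / (k : ℝ) ^ 2)) hinj]
          exact ENNReal.sum_le_tsum _
        · rw [Finset.filter_false_of_mem fun Q hQ h => hxR (hR Q hQ h)]
          simp
    _ = _ := lintegral_indicator_const R.measurableSet_carrier _

open scoped Classical in
theorem exists_sum_vol_rpow_mul_measure_rpow_le (hn : 1 ≤ n) {a : ℝ} (ha : 0 < a) (ha1 : a ≤ 1)
    {H : ℝ≥0∞} (hH : H ≠ ⊤) :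
    ∃ C : ℝ≥0∞, C ≠ ⊤ ∧ ∀ (T : Finset (Cube n)) (_ : ∀ Q ∈ T, Q.IsDyadic) (R : Cube n)
      (_ : ∀ Q ∈ T, Q.carrier ⊆ R.carrier)
      (_ : ∑ Q ∈ T, ENNReal.ofReal Q.vol ≤ H * ENNReal.ofReal R.vol)
      (_ : ∀ Q ∈ T, ∑ Q' ∈ T with Q'.carrier ⊆ Q.carrier, ENNReal.ofReal Q'.vol ≤
        H * ENNReal.ofReal Q.vol)
      (ν : Measure (Fin n → ℝ)) (_ : ν ≪ volume),
      ∑ Q ∈ T, ENNReal.ofReal Q.vol ^ a * ν Q.carrier ^ (1 - a) ≤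
        C * (ENNReal.ofReal R.vol ^ a * ν R.carrier ^ (1 - a)) := by
  set κ : ℝ := 2 * (1 - a) / a with hκ
  have hκ0 : 0 ≤ κ := div_nonneg (by linarith) ha.le
  set K : ℝ≥0∞ := ENNReal.ofReal (κ + 1) ^ (κ + 1) * (H ^ (κ + 1) * H) with hK
  refine ⟨K ^ a * invSqSum ^ (1 - a), ?_, ?_⟩
  · refine ENNReal.mul_ne_top (ENNReal.rpow_ne_top_of_nonneg ha.le ?_)
      (ENNReal.rpow_ne_top_of_nonneg (by linarith) invSqSum_ne_top)
    refine ENNReal.mul_ne_top (ENNReal.rpow_ne_top_of_nonneg (by linarith) ENNReal.ofReal_ne_top)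
      (ENNReal.mul_ne_top (ENNReal.rpow_ne_top_of_nonneg (by linarith) hH) hH)
  intro T hT R hR hHR hHT ν hν
  set N : Cube n → ℕ := fun Q => (T.filter (fun Q' => Q.carrier ⊆ Q'.carrier)).card with hN
  have hN1 : ∀ Q ∈ T, 1 ≤ N Q := fun Q hQ =>
    Finset.card_pos.2 ⟨Q, Finset.mem_filter.2 ⟨hQ, subset_rfl⟩⟩
  have hV : ∑ Q ∈ T, ENNReal.ofReal Q.vol * (N Q : ℝ≥0∞) ^ κ ≤ K * ENNReal.ofReal R.vol := by
    have h := ENNReal.sum_mul_ancestors_rpow_le T (fun Q Q' => Q.carrier ⊆ Q'.carrier) Cube.side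
      (fun i _ j hj k hk hij hik hs => (hT j hj).chain (hT k hk) hij hik hs) (fun _ => 1)
      (fun Q => ENNReal.ofReal Q.vol) (fun _ => H) (by simp) (by simp)
      (fun Q hQ => by simpa [mul_comm] using hHT Q hQ) (c := κ + 1) (by linarith)
    simp only [one_mul, Finset.sum_const, nsmul_eq_mul, mul_one] at h
    calc ∑ Q ∈ T, ENNReal.ofReal Q.vol * (N Q : ℝ≥0∞) ^ κ
        ≤ ∑ Q ∈ T, ENNReal.ofReal Q.vol * (N Q : ℝ≥0∞) ^ (κ + 1) := by
          refine Finset.sum_le_sum fun Q hQ => mul_le_mul_right ?_ _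
          exact ENNReal.rpow_le_rpow_of_exponent_le (by exact_mod_cast hN1 Q hQ) (by linarith)
      _ ≤ _ := h
      _ = ENNReal.ofReal (κ + 1) ^ (κ + 1) * (H ^ (κ + 1) * ∑ Q ∈ T, ENNReal.ofReal Q.vol) := by
          rw [← Finset.sum_mul]; ring
      _ ≤ ENNReal.ofReal (κ + 1) ^ (κ + 1) * (H ^ (κ + 1) * (H * ENNReal.ofReal R.vol)) := by
          gcongr
      _ = _ := by rw [hK]; ring
  have hσ := sum_measure_mul_inv_sq_card_le hn hν T hT R hR
  calc ∑ Q ∈ T, ENNReal.ofReal Q.vol ^ a * ν Q.carrier ^ (1 - a)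
      = ∑ Q ∈ T, (ENNReal.ofReal Q.vol * (N Q : ℝ≥0∞) ^ κ) ^ a *
          (ν Q.carrier * ENNReal.ofReal (1 / (N Q : ℝ) ^ 2)) ^ (1 - a) := by
        refine Finset.sum_congr rfl fun Q hQ => ?_
        have hNp : (0 : ℝ) < N Q := by exact_mod_cast hN1 Q hQ
        have e : (N Q : ℝ≥0∞) = ENNReal.ofReal (Real.exp (Real.log (N Q))) := by
          rw [Real.exp_log hNp, ENNReal.ofReal_natCast]
        have e2 : ENNReal.ofReal (1 / (N Q : ℝ) ^ 2) =
            ENNReal.ofReal (Real.exp (-(2 * Real.log (N Q)))) := by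
          rw [Real.exp_neg, two_mul, Real.exp_add, Real.exp_log hNp, sq, one_div]
        have e3 : ((N Q : ℝ≥0∞) ^ κ) ^ a * ENNReal.ofReal (1 / (N Q : ℝ) ^ 2) ^ (1 - a) = 1 := by
          rw [e, e2, ENNReal.ofReal_exp_rpow, ENNReal.ofReal_exp_rpow, ENNReal.ofReal_exp_rpow,
            ENNReal.ofReal_exp_mul]
          have : Real.log (N Q) * κ * a + -(2 * Real.log (N Q)) * (1 - a) = 0 := by
            rw [hκ]; field_simp; ring
          rw [this]; simp
        rw [ENNReal.mul_rpow_of_nonneg _ _ ha.le, ENNReal.mul_rpow_of_nonneg _ _ (by linarith),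
          mul_mul_mul_comm, e3, mul_one]
    _ ≤ _ := ENNReal.sum_rpow_mul_rpow_le T _ _ ha.le ha1
    _ ≤ (K * ENNReal.ofReal R.vol) ^ a * (invSqSum * ν R.carrier) ^ (1 - a) := by
        gcongr
    _ = _ := by
        rw [ENNReal.mul_rpow_of_nonneg K _ ha.le,
          ENNReal.mul_rpow_of_nonneg invSqSum _ (by linarith), mul_mul_mul_comm]

open scoped Classical in
theorem exists_sum_vol_rpow_mul_measure_rpow_mul_le (hn : 1 ≤ n) {a b c : ℝ} (ha : 0 < a)
    (hb : 0 < b) (hc : 0 < c) (habc : 1 ≤ a + b + c) {H : ℝ≥0∞} (hH : H ≠ ⊤) :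
    ∃ C : ℝ≥0∞, C ≠ ⊤ ∧ ∀ (T : Finset (Cube n)) (_ : ∀ Q ∈ T, Q.IsDyadic) (R : Cube n)
      (_ : ∀ Q ∈ T, Q.carrier ⊆ R.carrier)
      (_ : ∑ Q ∈ T, ENNReal.ofReal Q.vol ≤ H * ENNReal.ofReal R.vol)
      (_ : ∀ Q ∈ T, ∑ Q' ∈ T with Q'.carrier ⊆ Q.carrier, ENNReal.ofReal Q'.vol ≤
        H * ENNReal.ofReal Q.vol)
      (ν μ : Measure (Fin n → ℝ)) (_ : ν ≪ volume) (_ : μ ≪ volume),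
      ∑ Q ∈ T, ENNReal.ofReal Q.vol ^ a * ν Q.carrier ^ b * μ Q.carrier ^ c ≤
        C * (ENNReal.ofReal R.vol ^ a * ν R.carrier ^ b * μ R.carrier ^ c) := by
  set τ := a + b + c with hτ
  have hτ0 : 0 < τ := by linarith
  obtain ⟨C, hC, hCT⟩ := exists_sum_vol_rpow_mul_measure_rpow_le hn (a := a / τ) (by positivity)
    (by rw [div_le_one hτ0]; linarith) hH
  refine ⟨C, hC, fun T hT R hR hHR hHT ν μ hν hμ => ?_⟩
  have h1 := hCT T hT R hR hHR hHT ν hν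
  have h2 := hCT T hT R hR hHR hHT μ hμ
  set θ := b / (b + c) with hθ
  have hθ0 : 0 ≤ θ := by positivity
  have hθ1 : θ ≤ 1 := by rw [hθ, div_le_one (by positivity)]; linarith
  have key : ∀ V s w : ℝ≥0∞, (V ^ (a / τ) * s ^ (1 - a / τ)) ^ θ *
      (V ^ (a / τ) * w ^ (1 - a / τ)) ^ (1 - θ) = V ^ (a / τ) * s ^ (b / τ) * w ^ (c / τ) := by
    intro V s w
    rw [ENNReal.mul_rpow_of_nonneg _ _ hθ0, ENNReal.mul_rpow_of_nonneg _ _ (by linarith),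
      mul_mul_mul_comm, ← ENNReal.rpow_add_of_nonneg _ _ hθ0 (by linarith),
      ← ENNReal.rpow_mul s, ← ENNReal.rpow_mul w]
    have e1 : (1 - a / τ) * θ = b / τ := by
      rw [hθ, hτ]; field_simp; ring
    have e2 : (1 - a / τ) * (1 - θ) = c / τ := by
      rw [hθ, hτ]; field_simp; ring
    rw [e1, e2]; simp [mul_assoc]
  have main : ∑ Q ∈ T, ENNReal.ofReal Q.vol ^ (a / τ) * ν Q.carrier ^ (b / τ) *
      μ Q.carrier ^ (c / τ) ≤ C * (ENNReal.ofReal R.vol ^ (a / τ) * ν R.carrier ^ (b / τ) *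
      μ R.carrier ^ (c / τ)) := by
    simp only [← key]
    refine (ENNReal.sum_rpow_mul_rpow_le T _ _ hθ0 hθ1).trans ?_
    calc _ ≤ (C * (ENNReal.ofReal R.vol ^ (a / τ) * ν R.carrier ^ (1 - a / τ))) ^ θ *
          (C * (ENNReal.ofReal R.vol ^ (a / τ) * μ R.carrier ^ (1 - a / τ))) ^ (1 - θ) := by
          gcongr
      _ = _ := by
          rw [ENNReal.mul_rpow_of_nonneg _ _ hθ0, ENNReal.mul_rpow_of_nonneg C _ (by linarith),
            mul_mul_mul_comm, ← ENNReal.rpow_add_of_nonneg _ _ hθ0 (by linarith)]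
          simp
  have split : ∀ (x : ℝ≥0∞) (t : ℝ), 0 ≤ t → x ^ t = x ^ (t / τ) * x ^ (t - t / τ) := by
    intro x t ht
    have : t / τ ≤ t := div_le_self ht habc
    rw [← ENNReal.rpow_add_of_nonneg _ _ (by positivity) (by linarith)]
    congr 1; ring
  have hsub : ∀ t : ℝ, 0 ≤ t → 0 ≤ t - t / τ := fun t ht => by
    have := div_le_self ht habc; linarith
  set P : ℝ≥0∞ := ENNReal.ofReal R.vol ^ (a - a / τ) * ν R.carrier ^ (b - b / τ) *
    μ R.carrier ^ (c - c / τ) with hP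
  calc _ ≤ ∑ Q ∈ T, (ENNReal.ofReal Q.vol ^ (a / τ) * ν Q.carrier ^ (b / τ) *
      μ Q.carrier ^ (c / τ)) * P := by
        refine Finset.sum_le_sum fun Q hQ => ?_
        rw [split _ a ha.le, split _ b hb.le, split _ c hc.le]
        calc _ = (ENNReal.ofReal Q.vol ^ (a / τ) * ν Q.carrier ^ (b / τ) *
              μ Q.carrier ^ (c / τ)) * (ENNReal.ofReal Q.vol ^ (a - a / τ) *
              ν Q.carrier ^ (b - b / τ) * μ Q.carrier ^ (c - c / τ)) := by ring
          _ ≤ _ := by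
              have hv : ENNReal.ofReal Q.vol ≤ ENNReal.ofReal R.vol := by
                rw [← volume_carrier, ← volume_carrier]; exact measure_mono (hR Q hQ)
              refine mul_le_mul_right (mul_le_mul' (mul_le_mul' ?_ ?_) ?_) _
              · exact ENNReal.rpow_le_rpow hv (hsub a ha.le)
              · exact ENNReal.rpow_le_rpow (measure_mono (hR Q hQ)) (hsub b hb.le)
              · exact ENNReal.rpow_le_rpow (measure_mono (hR Q hQ)) (hsub c hc.le)
    _ ≤ C * (ENNReal.ofReal R.vol ^ (a / τ) * ν R.carrier ^ (b / τ) *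
      μ R.carrier ^ (c / τ)) * P := by
        rw [← Finset.sum_mul]; gcongr
    _ = _ := by
        rw [split _ a ha.le, split (ν R.carrier) b hb.le, split (μ R.carrier) c hc.le, hP]; ring

end Cube

section Weights

variable {n : ℕ}

/-- The measure `w dx`. -/
def wMeasure (w : (Fin n → ℝ) → ℝ) : Measure (Fin n → ℝ) :=
  volume.withDensity fun x => ENNReal.ofReal (w x)

theorem wMeasure_absolutelyContinuous (w : (Fin n → ℝ) → ℝ) : wMeasure w ≪ volume :=
  withDensity_absolutelyContinuous _ _

theorem wMeasure_carrier (w : (Fin n → ℝ) → ℝ) (Q : Cube n) :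
    wMeasure w Q.carrier = wMass w Q :=
  withDensity_apply _ Q.measurableSet_carrier

theorem wMass_mono (w : (Fin n → ℝ) → ℝ) {Q R : Cube n} (h : Q.carrier ⊆ R.carrier) :
    wMass w Q ≤ wMass w R :=
  lintegral_mono_set h

theorem IsWeight.wMass_ne_top {w : (Fin n → ℝ) → ℝ} (hw : IsWeight w) (Q : Cube n) :
    wMass w Q ≠ ⊤ := by
  have hQ : IsCompact Q.carrier := by rw [Q.carrier_eq_Icc]; exact isCompact_Icc
  exact (hw.1.integrableOn_isCompact hQ).lintegral_lt_top.ne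

theorem IsWeight.eNorm_eq {w : (Fin n → ℝ) → ℝ} (hw : IsWeight w) (s : ℝ)
    {g : (Fin n → ℝ) → ℝ≥0∞} (hg : Measurable g) :
    eNorm s w g = (∫⁻ x, g x ^ s ∂wMeasure w) ^ (1 / s) := by
  rw [eNorm, wMeasure, lintegral_withDensity_eq_lintegral_mul₀
    hw.1.aestronglyMeasurable.aemeasurable.ennreal_ofReal (hg.pow_const s).aemeasurable]
  simp only [Pi.mul_apply, mul_comm]

theorem IsSparse.sum_vol_le {η : ℝ} (hη : 0 < η) {S : Set (Cube n)} (hS : IsSparse η S)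
    (T : Finset (Cube n)) (hT : ∀ Q ∈ T, Q ∈ S) (R : Cube n)
    (hR : ∀ Q ∈ T, Q.carrier ⊆ R.carrier) :
    ∑ Q ∈ T, ENNReal.ofReal Q.vol ≤ (ENNReal.ofReal η)⁻¹ * ENNReal.ofReal R.vol := by
  obtain ⟨E, hm, hsub, hd, hE⟩ := hS
  have hη' : ENNReal.ofReal η ≠ 0 := by simpa using hη
  rw [← ENNReal.div_eq_inv_mul, ENNReal.le_div_iff_mul_le (.inl hη') (.inl ENNReal.ofReal_ne_top),
    Finset.sum_mul]
  calc ∑ Q ∈ T, ENNReal.ofReal Q.vol * ENNReal.ofReal η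
      ≤ ∑ Q ∈ T, volume (E Q) := Finset.sum_le_sum fun Q hQ => by
        rw [mul_comm, ← ENNReal.ofReal_mul hη.le]; exact hE Q (hT Q hQ)
    _ = volume (⋃ Q ∈ T, E Q) := (measure_biUnion_finset
        (fun Q hQ Q' hQ' hne => hd (hT Q hQ) (hT Q' hQ') hne) fun Q hQ => hm Q (hT Q hQ)).symm
    _ ≤ volume R.carrier :=
        measure_mono (Set.iUnion₂_subset fun Q hQ => (hsub Q (hT Q hQ)).trans (hR Q hQ))
    _ = _ := R.volume_carrier

theorem le_maximal_indicator {w : (Fin n → ℝ) → ℝ} (hw : ∀ x, 0 ≤ w x) {Q R : Cube n}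
    (h : Q.carrier ⊆ R.carrier) {x : Fin n → ℝ} (hx : x ∈ Q.carrier) :
    (ENNReal.ofReal Q.vol)⁻¹ * wMass w Q ≤ maximal (R.carrier.indicator w) x := by
  have e : wMass w Q = ∫⁻ y in Q.carrier, ENNReal.ofReal |R.carrier.indicator w y| := by
    refine setLIntegral_congr_fun Q.measurableSet_carrier fun y hy => ?_
    simp only [Set.indicator_of_mem (h hy), abs_of_nonneg (hw y)]
  rw [e]
  exact le_iSup₂_of_le (f := fun (P : Cube n) (_ : x ∈ P.carrier) => (ENNReal.ofReal P.vol)⁻¹ *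
    ∫⁻ y in P.carrier, ENNReal.ofReal |R.carrier.indicator w y|) Q hx le_rfl

/-- Carleson embedding: the masses of an `A∞` weight over a sparse collection sum up. -/
theorem IsSparse.sum_wMass_le {η : ℝ} (hη : 0 < η) {S : Set (Cube n)} (hS : IsSparse η S)
    {w : (Fin n → ℝ) → ℝ} (hw : IsWeight w)
    (T : Finset (Cube n)) (hT : ∀ Q ∈ T, Q ∈ S) (R : Cube n)
    (hR : ∀ Q ∈ T, Q.carrier ⊆ R.carrier) :
    ∑ Q ∈ T, wMass w Q ≤ (ENNReal.ofReal η)⁻¹ * AinfChar w * wMass w R := by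
  rcases eq_or_ne (wMass w R) 0 with h0 | h0
  · rw [Finset.sum_eq_zero fun Q hQ => le_zero_iff.1 ((wMass_mono w (hR Q hQ)).trans h0.le)]
    exact zero_le
  obtain ⟨E, hm, hsub, hd, hE⟩ := hS
  have hη' : ENNReal.ofReal η ≠ 0 := by simpa using hη
  have hA : ∫⁻ x in R.carrier, maximal (R.carrier.indicator w) x ≤ AinfChar w * wMass w R := by
    rw [← ENNReal.div_le_iff h0 (hw.wMass_ne_top R), ENNReal.div_eq_inv_mul]
    exact le_iSup (fun Q : Cube n => (wMass w Q)⁻¹ *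
      ∫⁻ x in Q.carrier, maximal (Q.carrier.indicator w) x) R
  rw [mul_assoc]
  refine le_trans ?_ (mul_le_mul_right hA _)
  rw [← ENNReal.div_eq_inv_mul, ENNReal.le_div_iff_mul_le (.inl hη') (.inl ENNReal.ofReal_ne_top),
    Finset.sum_mul]
  calc ∑ Q ∈ T, wMass w Q * ENNReal.ofReal η
      ≤ ∑ Q ∈ T, ∫⁻ x in E Q, maximal (R.carrier.indicator w) x := by
        refine Finset.sum_le_sum fun Q hQ => ?_
        have hV : ENNReal.ofReal Q.vol ≠ 0 := by simpa using Q.vol_pos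
        calc wMass w Q * ENNReal.ofReal η
            = (ENNReal.ofReal Q.vol)⁻¹ * wMass w Q * ENNReal.ofReal (η * Q.vol) := by
              rw [ENNReal.ofReal_mul hη.le,
                show (ENNReal.ofReal Q.vol)⁻¹ * wMass w Q * (ENNReal.ofReal η * ENNReal.ofReal Q.vol)
                = ENNReal.ofReal Q.vol * (ENNReal.ofReal Q.vol)⁻¹ *
                  (wMass w Q * ENNReal.ofReal η) by ring,
                ENNReal.mul_inv_cancel hV ENNReal.ofReal_ne_top, one_mul]
          _ ≤ (ENNReal.ofReal Q.vol)⁻¹ * wMass w Q * volume (E Q) := by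
              gcongr; exact hE Q (hT Q hQ)
          _ = ∫⁻ x in E Q, (ENNReal.ofReal Q.vol)⁻¹ * wMass w Q := by
              rw [setLIntegral_const]
          _ ≤ _ := setLIntegral_mono' (hm Q (hT Q hQ)) fun x hx =>
              le_maximal_indicator hw.2 (hR Q hQ) (hsub Q (hT Q hQ) hx)
    _ = ∫⁻ x in ⋃ Q ∈ T, E Q, maximal (R.carrier.indicator w) x := (lintegral_biUnion_finset
        (fun Q hQ Q' hQ' hne => hd (hT Q hQ) (hT Q' hQ') hne) (fun Q hQ => hm Q (hT Q hQ)) _).symm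
    _ ≤ _ := lintegral_mono_set
        (Set.iUnion₂_subset fun Q hQ => (hsub Q (hT Q hQ)).trans (hR Q hQ))

theorem le_twoWeightChar (p q α : ℝ) {S : Set (Cube n)} (w σ' : (Fin n → ℝ) → ℝ) {Q : Cube n}
    (hQ : Q ∈ S) : ENNReal.ofReal Q.vol ^ (-α) * wMass w Q ^ (1 / q) * wMass σ' Q ^ (1 - 1 / p) ≤
      twoWeightChar p q α S w σ' :=
  le_iSup₂_of_le (f := fun (Q : Cube n) (_ : Q ∈ S) => ENNReal.ofReal Q.vol ^ (-α) *
    wMass w Q ^ (1 / q) * wMass σ' Q ^ (1 - 1 / p)) Q hQ le_rfl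

end Weights

section Testing

theorem ENNReal.testing_eq {V σ ω : ℝ≥0∞} (hV0 : V ≠ 0) (hVt : V ≠ ⊤) (hσ0 : σ ≠ 0)
    (hσt : σ ≠ ⊤) (hω0 : ω ≠ 0) (hωt : ω ≠ ⊤) (p q r α t : ℝ) :
    V ^ (-(α * r)) * σ ^ (r - 1) * ω * σ =
      (V ^ (-α) * ω ^ (1 / q) * σ ^ (1 - 1 / p)) ^ t *
        (V ^ (α * (t - r)) * σ ^ (r - t * (1 - 1 / p)) * ω ^ (1 - t / q)) := by
  obtain ⟨x, rfl⟩ := ENNReal.exists_eq_ofReal_exp hV0 hVt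
  obtain ⟨y, rfl⟩ := ENNReal.exists_eq_ofReal_exp hσ0 hσt
  obtain ⟨z, rfl⟩ := ENNReal.exists_eq_ofReal_exp hω0 hωt
  simp only [ENNReal.ofReal_exp_rpow, ENNReal.ofReal_exp_mul]
  congr 2
  ring

theorem ENNReal.testing_mul_eq {V σ ω : ℝ≥0∞} (hV0 : V ≠ 0) (hVt : V ≠ ⊤) (hσ0 : σ ≠ 0)
    (hσt : σ ≠ ⊤) (hω0 : ω ≠ 0) (hωt : ω ≠ ⊤) {p q r α t s : ℝ} (hp : 0 < p) (hq : 0 < q)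
    (hrp : r < p) (hs : s = p / (p - r)) :
    V ^ (-(α * r)) * σ ^ (r - 1) * ω * σ *
        (σ⁻¹ * (V ^ (α * (t - r)) * σ ^ (r - t * (1 - 1 / p)) * ω ^ (1 - t / q))) ^ (s - 1) =
      (V ^ (-α) * ω ^ (1 / q) * σ ^ (1 - 1 / p)) ^ (r - (t - r) * (s - 1)) *
        ω ^ (s * (1 - r / q)) := by
  obtain ⟨x, rfl⟩ := ENNReal.exists_eq_ofReal_exp hV0 hVt
  obtain ⟨y, rfl⟩ := ENNReal.exists_eq_ofReal_exp hσ0 hσt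
  obtain ⟨z, rfl⟩ := ENNReal.exists_eq_ofReal_exp hω0 hωt
  simp only [ENNReal.ofReal_exp_rpow, ENNReal.ofReal_exp_mul, ENNReal.ofReal_exp_inv]
  congr 2
  have hd : p - r ≠ 0 := by linarith
  subst hs
  field_simp
  ring

theorem ENNReal.sum_testing_le {ι : Type*} (T : Finset ι) (le : ι → ι → Prop) [DecidableRel le]
    (V σ ω : ι → ℝ≥0∞) (hV0 : ∀ i ∈ T, V i ≠ 0) (hVt : ∀ i ∈ T, V i ≠ ⊤)
    (hσ0 : ∀ i ∈ T, σ i ≠ 0) (hσt : ∀ i ∈ T, σ i ≠ ⊤)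
    (hω0 : ∀ i ∈ T, ω i ≠ 0) (hωt : ∀ i ∈ T, ω i ≠ ⊤) {p q r α t s : ℝ} (hp : 0 < p)
    (hpq : p ≤ q) (hr : 0 < r) (hrp : r < p) (hs : s = p / (p - r)) (ht : 0 ≤ t)
    (hu : 0 ≤ r - (t - r) * (s - 1)) {A B W M : ℝ≥0∞}
    (hA : ∀ i ∈ T, V i ^ (-α) * ω i ^ (1 / q) * σ i ^ (1 - 1 / p) ≤ A)
    (hB : ∀ i ∈ T, ∑ j ∈ T with le j i,
        V j ^ (α * (t - r)) * σ j ^ (r - t * (1 - 1 / p)) * ω j ^ (1 - t / q) ≤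
      B * (V i ^ (α * (t - r)) * σ i ^ (r - t * (1 - 1 / p)) * ω i ^ (1 - t / q)))
    (hW : ∑ i ∈ T, ω i ≤ W * M) (hM : ∀ i ∈ T, ω i ≤ M) :
    ∑ i ∈ T, V i ^ (-(α * r)) * σ i ^ (r - 1) * ω i * σ i *
        ((σ i)⁻¹ * ∑ j ∈ T with le j i, V j ^ (-(α * r)) * σ j ^ (r - 1) * ω j * σ j) ^ (s - 1) ≤
      A ^ (r * s) * B ^ (s - 1) * W * M ^ (s * (1 - r / q)) := by
  have hd : 0 < p - r := by linarith
  have hq : 0 < q := by linarith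
  have hs1 : 0 ≤ s - 1 := by
    rw [hs, sub_nonneg, one_le_div hd]; linarith
  have he : 0 ≤ s * (1 - r / q) - 1 := by
    have : s * (1 - r / q) - 1 = r * (q - p) / (q * (p - r)) := by
      rw [hs]; field_simp; ring
    rw [this]
    have := sub_nonneg.2 hpq
    positivity
  set G : ι → ℝ≥0∞ := fun i =>
    V i ^ (α * (t - r)) * σ i ^ (r - t * (1 - 1 / p)) * ω i ^ (1 - t / q) with hG
  have hsum : ∀ i ∈ T, ∑ j ∈ T with le j i, V j ^ (-(α * r)) * σ j ^ (r - 1) * ω j * σ j ≤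
      A ^ t * B * G i := fun i hi => by
    rw [mul_assoc]
    refine le_trans ?_ (mul_le_mul_right (hB i hi) _)
    rw [Finset.mul_sum]
    refine Finset.sum_le_sum fun j hj => ?_
    have hj := (Finset.mem_filter.1 hj).1
    rw [ENNReal.testing_eq (hV0 j hj) (hVt j hj) (hσ0 j hj) (hσt j hj) (hω0 j hj) (hωt j hj) p q
      r α t]
    exact mul_le_mul_left (ENNReal.rpow_le_rpow (hA j hj) ht) _
  have hterm : ∀ i ∈ T, V i ^ (-(α * r)) * σ i ^ (r - 1) * ω i * σ i *
        ((σ i)⁻¹ * ∑ j ∈ T with le j i, V j ^ (-(α * r)) * σ j ^ (r - 1) * ω j * σ j) ^ (s - 1) ≤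
      A ^ (r * s) * B ^ (s - 1) * (ω i * M ^ (s * (1 - r / q) - 1)) := fun i hi => by
    calc _ ≤ V i ^ (-(α * r)) * σ i ^ (r - 1) * ω i * σ i *
          ((σ i)⁻¹ * (A ^ t * B * G i)) ^ (s - 1) :=
          mul_le_mul_right (ENNReal.rpow_le_rpow (mul_le_mul_right (hsum i hi) _) hs1) _
      _ = (A ^ t * B) ^ (s - 1) * (V i ^ (-(α * r)) * σ i ^ (r - 1) * ω i * σ i *
          ((σ i)⁻¹ * G i) ^ (s - 1)) := by
          rw [mul_left_comm (σ i)⁻¹, ENNReal.mul_rpow_of_nonneg (A ^ t * B) _ hs1, mul_left_comm]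
      _ = (A ^ t * B) ^ (s - 1) * ((V i ^ (-α) * ω i ^ (1 / q) * σ i ^ (1 - 1 / p)) ^
            (r - (t - r) * (s - 1)) * ω i ^ (s * (1 - r / q))) := by
          rw [ENNReal.testing_mul_eq (hV0 i hi) (hVt i hi) (hσ0 i hi) (hσt i hi) (hω0 i hi)
            (hωt i hi) hp hq hrp hs]
      _ ≤ (A ^ t * B) ^ (s - 1) * (A ^ (r - (t - r) * (s - 1)) *
            (ω i * M ^ (s * (1 - r / q) - 1))) := by
          refine mul_le_mul_right (mul_le_mul' (ENNReal.rpow_le_rpow (hA i hi) hu) ?_) _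
          calc ω i ^ (s * (1 - r / q)) = ω i * ω i ^ (s * (1 - r / q) - 1) := by
                conv_rhs => enter [1]; rw [← ENNReal.rpow_one (ω i)]
                rw [← ENNReal.rpow_add_of_nonneg _ _ zero_le_one he]
                congr 1; ring
            _ ≤ _ := mul_le_mul_right (ENNReal.rpow_le_rpow (hM i hi) he) _
      _ = _ := by
          rw [ENNReal.mul_rpow_of_nonneg _ _ hs1, ← ENNReal.rpow_mul,
            show r * s = t * (s - 1) + (r - (t - r) * (s - 1)) by ring,
            ENNReal.rpow_add_of_nonneg _ _ (mul_nonneg ht hs1) hu]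
          ring
  calc _ ≤ ∑ i ∈ T, A ^ (r * s) * B ^ (s - 1) * (ω i * M ^ (s * (1 - r / q) - 1)) :=
        Finset.sum_le_sum hterm
    _ = A ^ (r * s) * B ^ (s - 1) * ((∑ i ∈ T, ω i) * M ^ (s * (1 - r / q) - 1)) := by
        rw [← Finset.mul_sum, ← Finset.sum_mul]
    _ ≤ A ^ (r * s) * B ^ (s - 1) * (W * M * M ^ (s * (1 - r / q) - 1)) := by gcongr
    _ = _ := by
        have : M ^ (s * (1 - r / q)) = M * M ^ (s * (1 - r / q) - 1) := by
          conv_rhs => enter [1]; rw [← ENNReal.rpow_one M]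
          rw [← ENNReal.rpow_add_of_nonneg _ _ zero_le_one he]
          congr 1; ring
        rw [this]; ring

end Testing

section TestingConstant

variable {n : ℕ}

theorem lintegral_cubeSum_rpow_le {ν : Measure (Fin n → ℝ)} {D : Set (Cube n)}
    (hD : D.Countable) (g : Cube n → ℝ≥0∞) {s : ℝ} (hs : 0 < s) {K : ℝ≥0∞}
    (h : ∀ T : Finset (Cube n), (∀ Q ∈ T, Q ∈ D) →
      ∫⁻ x, (∑ Q ∈ T, Q.carrier.indicator (fun _ => g Q) x) ^ s ∂ν ≤ K) :
    ∫⁻ x, cubeSum D g x ^ s ∂ν ≤ K := by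
  have : Countable D := hD.to_subtype
  have hm : ∀ F : Finset D, Measurable fun x =>
      (∑ Q ∈ F, Q.1.carrier.indicator (fun _ => g Q.1) x) ^ s := fun F =>
    (Finset.measurable_fun_sum _ fun Q _ =>
      measurable_const.indicator Q.1.measurableSet_carrier).pow_const s
  have e : ∀ x, cubeSum D g x ^ s =
      ⨆ F : Finset D, (∑ Q ∈ F, Q.1.carrier.indicator (fun _ => g Q.1) x) ^ s := fun x => by
    rw [cubeSum, ENNReal.tsum_eq_iSup_sum]
    exact (ENNReal.orderIsoRpow s hs).map_iSup _
  simp only [e]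
  rw [lintegral_iSup_directed (fun F => (hm F).aemeasurable)]
  · refine iSup_le fun F => ?_
    have := h (F.map (Function.Embedding.subtype _)) (by simp +contextual)
    simpa using this
  · refine Monotone.directed_le fun F F' hFF' x => ?_
    exact ENNReal.rpow_le_rpow (Finset.sum_le_sum_of_subset hFF') hs.le

theorem measurable_cubeSum {D : Set (Cube n)} (hD : D.Countable) (g : Cube n → ℝ≥0∞) :
    Measurable (cubeSum D g) := by
  have : Countable D := hD.to_subtype
  exact Measurable.tsum fun Q => measurable_const.indicator Q.1.measurableSet_carrier

/-- The quantity `∑ |Q|^a σ(Q)^b ω(Q)^c` of a subcollection of `S` is controlled by its top cube,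
for the exponents produced by the testing condition with parameter `t`. -/
def IsSummableAt (p q r α t : ℝ) (S : Set (Cube n)) (w σ' : (Fin n → ℝ) → ℝ) (B : ℝ≥0∞) : Prop :=
  ∀ (T : Finset (Cube n)) (_ : ∀ Q ∈ T, Q ∈ S) (R : Cube n) (_ : ∀ Q ∈ T, Q.carrier ⊆ R.carrier),
    ∑ Q ∈ T, ENNReal.ofReal Q.vol ^ (α * (t - r)) * wMass σ' Q ^ (r - t * (1 - 1 / p)) *
        wMass w Q ^ (1 - t / q) ≤
      B * (ENNReal.ofReal R.vol ^ (α * (t - r)) * wMass σ' R ^ (r - t * (1 - 1 / p)) *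
        wMass w R ^ (1 - t / q))

open scoped Classical in
theorem lintegral_testing_le {p q r α η t s : ℝ} (hp : 0 < p) (hpq : p ≤ q) (hr : 0 < r)
    (hrp : r < p) (hη : 0 < η) (hs : s = p / (p - r)) (ht : 0 ≤ t)
    (hu : 0 ≤ r - (t - r) * (s - 1)) {w σ' : (Fin n → ℝ) → ℝ} (hw : IsWeight w)
    (hσ : IsWeight σ') {S : Set (Cube n)} (hSd : ∀ Q ∈ S, Q.IsDyadic) (hS : IsSparse η S)
    {B : ℝ≥0∞} (hB : IsSummableAt p q r α t S w σ' B) (R : Cube n)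
    (T : Finset (Cube n)) (hT : ∀ Q ∈ T, Q ∈ S ∧ Q.carrier ⊆ R.carrier) :
    ∫⁻ x, (∑ Q ∈ T, Q.carrier.indicator (fun _ => ENNReal.ofReal Q.vol ^ (-(α * r)) *
        wMass σ' Q ^ (r - 1) * wMass w Q) x) ^ s ∂wMeasure σ' ≤
      ENNReal.ofReal s * ENNReal.ofReal s ^ (s - 1) *
        (twoWeightChar p q α S w σ' ^ (r * s) * B ^ (s - 1) *
          ((ENNReal.ofReal η)⁻¹ * AinfChar w) * wMass w R ^ (s * (1 - r / q))) := by
  set l : Cube n → ℝ≥0∞ := fun Q => ENNReal.ofReal Q.vol ^ (-(α * r)) *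
        wMass σ' Q ^ (r - 1) * wMass w Q with hl
  have hV : ∀ Q : Cube n, ENNReal.ofReal Q.vol ≠ 0 := fun Q => by simpa using Q.vol_pos
  have hs1 : 1 ≤ s := by
    rw [hs, one_le_div (by linarith)]; linarith
  set T' := T.filter fun Q => wMass w Q ≠ 0 ∧ wMass σ' Q ≠ 0 with hT'
  have hT1 : ∀ Q ∈ T', Q ∈ T := fun Q hQ => (Finset.mem_filter.1 hQ).1
  have hw0 : ∀ Q ∈ T', wMass w Q ≠ 0 := fun Q hQ => (Finset.mem_filter.1 hQ).2.1
  have hσ0 : ∀ Q ∈ T', wMass σ' Q ≠ 0 := fun Q hQ => (Finset.mem_filter.1 hQ).2.2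
  have hle : ∫⁻ x, (∑ Q ∈ T, Q.carrier.indicator (fun _ => l Q) x) ^ s ∂wMeasure σ' =
      ∫⁻ x, (∑ Q ∈ T', Q.carrier.indicator (fun _ => l Q) x) ^ s ∂wMeasure σ' := by
    refine lintegral_congr_ae ?_
    have hnull : ∀ᵐ x ∂wMeasure σ', ∀ Q ∈ T, wMass σ' Q = 0 → x ∉ Q.carrier := by
      refine (ae_ball_iff T.countable_toSet).2 fun Q _ => ?_
      by_cases h : wMass σ' Q = 0
      · rw [← wMeasure_carrier] at h
        filter_upwards [measure_eq_zero_iff_ae_notMem.1 h] with x hx _ using hx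
      · exact Filter.Eventually.of_forall fun x h' => absurd h' h
    filter_upwards [hnull] with x hx
    congr 1
    refine (Finset.sum_subset (Finset.filter_subset _ _) fun Q hQ hQ' => ?_).symm
    by_cases h : wMass σ' Q = 0
    · exact Set.indicator_of_notMem (hx Q hQ h) _
    · have h0 : wMass w Q = 0 := by
        by_contra h0
        exact hQ' (Finset.mem_filter.2 ⟨hQ, h0, h⟩)
      simp [hl, h0]
  rw [hle]
  have hcov := Cube.lintegral_sum_rpow_le (wMeasure_absolutelyContinuous σ') T'
    (fun Q hQ => hSd Q (hT Q (hT1 Q hQ)).1) l (fun Q hQ => ?_)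
    (fun Q hQ => by rw [wMeasure_carrier]; exact hσ0 Q hQ)
    (fun Q hQ => by rw [wMeasure_carrier]; exact hσ.wMass_ne_top Q) hs1
  · refine hcov.trans (mul_le_mul_right ?_ _)
    simp only [wMeasure_carrier]
    exact ENNReal.sum_testing_le T' (fun Q' Q => Q'.carrier ⊆ Q.carrier)
      (fun Q => ENNReal.ofReal Q.vol) (wMass σ') (wMass w) (fun Q _ => hV Q)
      (fun Q _ => ENNReal.ofReal_ne_top) hσ0 (fun Q _ => hσ.wMass_ne_top Q) hw0
      (fun Q _ => hw.wMass_ne_top Q) hp hpq hr hrp hs ht hu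
      (fun Q hQ => le_twoWeightChar p q α w σ' (hT Q (hT1 Q hQ)).1)
      (fun Q hQ => hB _ (fun Q' hQ' => (hT Q' (hT1 Q' (Finset.mem_filter.1 hQ').1)).1) Q
        fun Q' hQ' => (Finset.mem_filter.1 hQ').2)
      (hS.sum_wMass_le hη hw T' (fun Q hQ => (hT Q (hT1 Q hQ)).1) R
        fun Q hQ => (hT Q (hT1 Q hQ)).2)
      (fun Q hQ => wMass_mono w (hT Q (hT1 Q hQ)).2)
  · refine ENNReal.mul_ne_top (ENNReal.mul_ne_top ?_ ?_) (hw.wMass_ne_top Q)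
    · simp [ENNReal.rpow_eq_top_iff, Q.vol_pos]
    · simp [ENNReal.rpow_eq_top_iff, hσ0 Q hQ, hσ.wMass_ne_top Q]

/-- The constant lost in passing from a discrete sum to the testing constant. -/
def testingConst (η s : ℝ) : ℝ≥0∞ :=
  ENNReal.ofReal s * ENNReal.ofReal s ^ (s - 1) * (ENNReal.ofReal η)⁻¹

theorem testTstar_le {p q r α η t : ℝ} (hp : 0 < p) (hpq : p ≤ q) (hr : 0 < r)
    (hrp : r < p) (hη : 0 < η) (ht : 0 ≤ t)
    (hu : 0 ≤ r - (t - r) * (p / (p - r) - 1)) {w σ' : (Fin n → ℝ) → ℝ} (hw : IsWeight w)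
    (hσ : IsWeight σ') {S : Set (Cube n)} (hSd : ∀ Q ∈ S, Q.IsDyadic) (hS : IsSparse η S)
    {B : ℝ≥0∞} (hB : IsSummableAt p q r α t S w σ' B) :
    testTstar p q r α S w σ' ≤ testingConst η (p / (p - r)) ^ (1 - r / p) *
      twoWeightChar p q α S w σ' ^ r * B ^ (r / p) * AinfChar w ^ (1 - r / p) := by
  have hd : 0 < p - r := by linarith
  have hq : 0 < q := by linarith
  set s := p / (p - r) with hs
  have hs0 : 0 < s := by positivity
  have hs' : p / r / (p / r - 1) = s := by rw [hs]; field_simp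
  have hinv : 1 / s = 1 - r / p := by rw [hs]; field_simp
  refine iSup₂_le fun R hR => ?_
  have hcount : {Q | Q ∈ S ∧ Q.carrier ⊆ R.carrier}.Countable :=
    Cube.countable_isDyadic.mono fun Q hQ => hSd Q hQ.1
  rw [hs', hσ.eNorm_eq s (measurable_cubeSum hcount _)]
  have h1 := lintegral_cubeSum_rpow_le hcount _ hs0
    (lintegral_testing_le hp hpq hr hrp hη hs ht hu hw hσ hSd hS hB R)
  set A := twoWeightChar p q α S w σ'
  set X := wMass w R
  have hX : X ^ (-(1 - r / q)) * X ^ (1 - r / q) ≤ 1 := by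
    rw [ENNReal.rpow_neg]
    exact ENNReal.inv_mul_le_one _
  have hrp' : 0 ≤ 1 - r / p := by rw [← hinv]; positivity
  calc _ ≤ X ^ (-(1 - r / q)) * (ENNReal.ofReal s * ENNReal.ofReal s ^ (s - 1) *
        (A ^ (r * s) * B ^ (s - 1) * ((ENNReal.ofReal η)⁻¹ * AinfChar w) *
          X ^ (s * (1 - r / q)))) ^ (1 / s) :=
        mul_le_mul_right (ENNReal.rpow_le_rpow h1 (by positivity)) _
    _ = X ^ (-(1 - r / q)) * (testingConst η s * A ^ (r * s) * B ^ (s - 1) * AinfChar w *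
          X ^ (s * (1 - r / q))) ^ (1 - r / p) := by
        rw [hinv, testingConst]; ring_nf
    _ = X ^ (-(1 - r / q)) * X ^ (1 - r / q) * (testingConst η s ^ (1 - r / p) * A ^ r *
          B ^ (r / p) * AinfChar w ^ (1 - r / p)) := by
        simp only [ENNReal.mul_rpow_of_nonneg _ _ hrp', ← ENNReal.rpow_mul]
        rw [show r * s * (1 - r / p) = r by rw [← hinv]; field_simp,
          show (s - 1) * (1 - r / p) = r / p by rw [hs]; field_simp; ring,
          show s * (1 - r / q) * (1 - r / p) = 1 - r / q by rw [← hinv]; field_simp]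
        ring
    _ ≤ _ := mul_le_of_le_one_left zero_le hX

end TestingConstant

section Constants

variable {n : ℕ}

theorem testingConst_ne_top {η s : ℝ} (hη : 0 < η) (hs : 1 ≤ s) : testingConst η s ≠ ⊤ :=
  ENNReal.mul_ne_top (ENNReal.mul_ne_top ENNReal.ofReal_ne_top
    (ENNReal.rpow_ne_top_of_nonneg (by linarith) ENNReal.ofReal_ne_top)) (by simpa using hη)

theorem isSummableAt_self {p r α η : ℝ} (hr : 0 < r) (hrp : r < p)
    (hη : 0 < η) {w σ' : (Fin n → ℝ) → ℝ} (hw : IsWeight w) (hσ : IsWeight σ')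
    {S : Set (Cube n)} (hS : IsSparse η S) :
    IsSummableAt p p r α r S w σ'
      ((ENNReal.ofReal η)⁻¹ * (AinfChar σ' ^ (r / p) * AinfChar w ^ (1 - r / p))) := by
  intro T hT R hR
  have hp : 0 < p := hr.trans hrp
  have h0 : 0 ≤ r / p := by positivity
  have h1 : r / p ≤ 1 := by rw [div_le_one hp]; exact hrp.le
  have hb : r - r * (1 - 1 / p) = r / p := by ring
  have ha : α * (r - r) = 0 := by ring
  simp only [ha, hb, ENNReal.rpow_zero, one_mul]
  have hH : ∀ x : ℝ≥0∞, x ^ (r / p) * x ^ (1 - r / p) = x := fun x => by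
    rw [← ENNReal.rpow_add_of_nonneg _ _ h0 (by linarith)]; simp
  refine (ENNReal.sum_rpow_mul_rpow_le T _ _ h0 h1).trans ?_
  calc _ ≤ ((ENNReal.ofReal η)⁻¹ * AinfChar σ' * wMass σ' R) ^ (r / p) *
        ((ENNReal.ofReal η)⁻¹ * AinfChar w * wMass w R) ^ (1 - r / p) :=
        mul_le_mul' (ENNReal.rpow_le_rpow (hS.sum_wMass_le hη hσ T hT R hR) h0)
          (ENNReal.rpow_le_rpow (hS.sum_wMass_le hη hw T hT R hR) (by linarith))
    _ = _ := by
        simp only [ENNReal.mul_rpow_of_nonneg _ _ h0,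
          ENNReal.mul_rpow_of_nonneg _ _ (sub_nonneg.2 h1)]
        conv_rhs => rw [← hH (ENNReal.ofReal η)⁻¹]
        ring

theorem exists_exponent {p q r α : ℝ} (hp : 1 < p) (hpq : p ≤ q) (hr : 0 < r) (hrp : r < p)
    (h : ¬(p = q ∧ α < 1)) (hα1 : α ≤ 1) :
    ∃ t, r < t ∧ 0 < r - t * (1 - 1 / p) ∧ 0 < 1 - t / q ∧
      1 ≤ α * (t - r) + (r - t * (1 - 1 / p)) + (1 - t / q) ∧
      0 < r - (t - r) * (p / (p - r) - 1) := by
  have hq : 0 < q := by linarith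
  have ev : ∀ f : ℝ → ℝ, Continuous f → 0 < f r →
      ∀ᶠ t in nhdsWithin r (Ioi r), 0 < f t := fun f hf h0 =>
    ((hf.tendsto r).eventually (lt_mem_nhds h0)).filter_mono nhdsWithin_le_nhds
  have e1 := ev (fun t => r - t * (1 - 1 / p)) (by fun_prop) (by
    have : r - r * (1 - 1 / p) = r / p := by ring
    simp only [this]; positivity)
  have e2 := ev (fun t => 1 - t / q) (by fun_prop) (by
    simp only [sub_pos]; rw [div_lt_one hq]; linarith)
  have e3 := ev (fun t => r - (t - r) * (p / (p - r) - 1)) (by fun_prop) (by simpa using hr)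
  have e4 : ∀ᶠ t in nhdsWithin r (Ioi r),
      1 ≤ α * (t - r) + (r - t * (1 - 1 / p)) + (1 - t / q) := by
    rcases hpq.eq_or_lt with rfl | hlt
    · have hα : α = 1 := le_antisymm hα1 (not_lt.1 fun h' => h ⟨rfl, h'⟩)
      refine Filter.Eventually.of_forall fun t => le_of_eq ?_
      rw [hα]; ring
    · have hinv : 1 / q < 1 / p := one_div_lt_one_div_of_lt (by linarith) hlt
      refine (ev (fun t => α * (t - r) + (r - t * (1 - 1 / p)) + (1 - t / q) - 1) (by fun_prop)
        ?_).mono fun t ht => by linarith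
      have : α * (r - r) + (r - r * (1 - 1 / p)) + (1 - r / q) - 1 = r * (1 / p - 1 / q) := by
        ring
      simp only [this]
      exact mul_pos hr (sub_pos.2 hinv)
  obtain ⟨t, ht, h1, h2, h3, h4⟩ :=
    ((eventually_mem_nhdsWithin (a := r) (s := Ioi r)).and
      (e1.and (e2.and (e4.and e3)))).exists
  exact ⟨t, ht, h1, h2, h3, h4⟩

theorem exists_isSummableAt (hn : 1 ≤ n) {p q r α η t : ℝ} (hα : 0 < α) (hη : 0 < η)
    (ht : r < t) (hb : 0 < r - t * (1 - 1 / p)) (hc : 0 < 1 - t / q)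
    (habc : 1 ≤ α * (t - r) + (r - t * (1 - 1 / p)) + (1 - t / q)) :
    ∃ C : ℝ≥0∞, C ≠ ⊤ ∧ ∀ (w σ' : (Fin n → ℝ) → ℝ) (S : Set (Cube n)),
      (∀ Q ∈ S, Q.IsDyadic) → IsSparse η S → IsSummableAt p q r α t S w σ' C := by
  classical
  obtain ⟨C, hC, h⟩ := Cube.exists_sum_vol_rpow_mul_measure_rpow_mul_le hn
    (mul_pos hα (sub_pos.2 ht)) hb hc habc (H := (ENNReal.ofReal η)⁻¹) (by simpa using hη)
  refine ⟨C, hC, fun w σ' S hSd hS T hT R hR => ?_⟩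
  have := h T (fun Q hQ => hSd Q (hT Q hQ)) R hR (hS.sum_vol_le hη T hT R hR)
    (fun Q hQ => hS.sum_vol_le hη _ (fun Q' hQ' => hT Q' (Finset.mem_filter.1 hQ').1) Q
      fun Q' hQ' => (Finset.mem_filter.1 hQ').2)
    (wMeasure σ') (wMeasure w) (wMeasure_absolutelyContinuous _) (wMeasure_absolutelyContinuous _)
  simpa only [wMeasure_carrier] using this

end Constants

theorem ENNReal.exists_pos_le_ofReal {c : ℝ≥0∞} (hc : c ≠ ⊤) :
    ∃ C : ℝ, 0 < C ∧ c ≤ ENNReal.ofReal C :=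
  ⟨c.toReal + 1, by positivity, by
    rw [← ENNReal.ofReal_toReal hc]; exact ENNReal.ofReal_le_ofReal (by simp)⟩

/-- sharp estimate for the testing constant `𝒯*` (case `p > r`). -/
theorem stmt12 (n : ℕ) (hn : 1 ≤ n) (p q r α η : ℝ)
    (hp : 1 < p) (hpq : p ≤ q) (hr : 0 < r) (hrp : r < p) (hα : 0 < α) (hα1 : α ≤ 1)
    (hη : 0 < η) (hη1 : η ≤ 1) (hscale : 0 ≤ -α + 1 / q + (1 - 1 / p)) :
    ∃ C : ℝ, 0 < C ∧
      ∀ ω σ' : (Fin n → ℝ) → ℝ, IsWeight ω → IsWeight σ' →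
        AinfChar ω < ∞ → AinfChar σ' < ∞ →
      ∀ S : Set (Cube n), (∀ Q ∈ S, Q.IsDyadic) → IsSparse η S →
        ((p = q ∧ α < 1) →
          testTstar p q r α S ω σ' ≤
            ENNReal.ofReal C * twoWeightChar p q α S ω σ' ^ r *
              (AinfChar ω ^ (1 - (r / p) ^ 2) * AinfChar σ' ^ ((r / p) ^ 2))) ∧
        (¬(p = q ∧ α < 1) →
          testTstar p q r α S ω σ' ≤
            ENNReal.ofReal C * twoWeightChar p q α S ω σ' ^ r *
              AinfChar ω ^ (1 - r / p)) := by

  have hd : 0 < p - r := by linarith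
  have hp0 : 0 < p := by linarith
  have hrp0 : 0 ≤ r / p := by positivity
  have hrp1 : 0 ≤ 1 - r / p := by rw [sub_nonneg, div_le_one hp0]; exact hrp.le
  have hs1 : 1 ≤ p / (p - r) := by rw [one_le_div hd]; linarith
  have hK := ENNReal.rpow_ne_top_of_nonneg hrp1 (testingConst_ne_top hη hs1)
  by_cases h : p = q ∧ α < 1
  · have hηt : (ENNReal.ofReal η)⁻¹ ≠ ⊤ := by simpa using hη
    obtain ⟨C, hC0, hC⟩ := ENNReal.exists_pos_le_ofReal
      (ENNReal.mul_ne_top hK (ENNReal.rpow_ne_top_of_nonneg hrp0 hηt))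
    refine ⟨C, hC0, fun ω σ' hω hσ _ _ S hSd hS => ⟨fun _ => ?_, fun h' => absurd h h'⟩⟩
    obtain ⟨rfl, -⟩ := h
    refine (testTstar_le hp0 le_rfl hr hrp hη hr.le (by simpa using hr.le) hω hσ hSd hS
      (isSummableAt_self hr hrp hη hω hσ hS)).trans ?_
    calc _ = testingConst η (p / (p - r)) ^ (1 - r / p) * (ENNReal.ofReal η)⁻¹ ^ (r / p) *
          twoWeightChar p p α S ω σ' ^ r *
          (AinfChar ω ^ (1 - (r / p) ^ 2) * AinfChar σ' ^ ((r / p) ^ 2)) := by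
          simp only [ENNReal.mul_rpow_of_nonneg _ _ hrp0, ← ENNReal.rpow_mul]
          rw [show 1 - (r / p) ^ 2 = (1 - r / p) * (r / p) + (1 - r / p) by ring,
            ENNReal.rpow_add_of_nonneg _ _ (mul_nonneg hrp1 hrp0) hrp1, sq]
          ring
      _ ≤ _ := by gcongr
  · obtain ⟨t, ht, hb, hc, habc, hu⟩ := exists_exponent hp hpq hr hrp h hα1
    obtain ⟨B, hBt, hB⟩ := exists_isSummableAt hn hα hη ht hb hc habc
    obtain ⟨C, hC0, hC⟩ := ENNReal.exists_pos_le_ofReal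
      (ENNReal.mul_ne_top hK (ENNReal.rpow_ne_top_of_nonneg hrp0 hBt))
    refine ⟨C, hC0, fun ω σ' hω hσ _ _ S hSd hS => ⟨fun h' => absurd h' h, fun _ => ?_⟩⟩
    refine (testTstar_le hp0 hpq hr hrp hη (hr.trans ht).le hu.le hω hσ hSd hS
      (hB ω σ' S hSd hS)).trans ?_
    rw [mul_right_comm (testingConst η (p / (p - r)) ^ (1 - r / p))]
    gcongr
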